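/- Let n ≥ 2 be an integer and w₀ > 0 real, and set w₊(z) = w₀ z^{−n + 3/2}(ln z − i), w₋(z) = w₀ z^{−n + 3/2}(ln z + i). For complex coefficients b¹₊, b¹₋, b²₊, b²₋ put w^j(z) = b^j₊ w₊(z) + b^j₋ w₋(z), j = 1, 2. Then for every ζ > 0, ζ^{2(n−1)} ( conj(w²(ζ)) · (w¹)′(ζ) − w¹(ζ) · conj((w²)′(ζ)) ) = 2 i w₀² ( conj(b²₊) b¹₊ − conj(b²₋) b¹₋ ). In particular, with the normalization w₀ = 2^{−1/2} this expression equals i ( conj(b²₊) b¹₊ − conj(b²₋) b¹₋ ) independently of ζ. -/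

import Mathlib

open Complex in
/-- Derivative of a combination of the two profiles `w₀ z^(3/2 - n) (ln z ∓ i)`. -/
theorem hasDerivAt_cusp_profile (n : ℕ) (w₀ : ℝ) (b c : ℂ) {x : ℝ} (hx : 0 < x) :
    HasDerivAt (fun z : ℝ =>
        b * ((w₀ : ℂ) * (z : ℂ) ^ ((3/2 : ℂ) - (n : ℂ)) * ((Real.log z : ℂ) - I)) +
        c * ((w₀ : ℂ) * (z : ℂ) ^ ((3/2 : ℂ) - (n : ℂ)) * ((Real.log z : ℂ) + I)))
      (w₀ * (((3/2 - n : ℝ) * x ^ ((3/2 - n : ℝ) - 1) : ℝ) *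
          ((b + c) * (Real.log x : ℂ) + (c - b) * I) +
        ((x ^ (3/2 - n : ℝ) : ℝ) : ℂ) * ((b + c) * ((x⁻¹ : ℝ) : ℂ)))) x := by
  have hr := (Real.hasDerivAt_rpow_const (p := (3/2 - n : ℝ)) (Or.inl hx.ne')).ofReal_comp
  have hl := (Real.hasDerivAt_log hx.ne').ofReal_comp
  have h := (hr.mul ((hl.const_mul (b + c)).add_const ((c - b) * I))).const_mul (w₀ : ℂ)
  refine h.congr_of_eventuallyEq ?_
  filter_upwards [lt_mem_nhds hx] with z hz
  have hp : (z : ℂ) ^ ((3/2 : ℂ) - (n : ℂ)) = ((z ^ (3/2 - n : ℝ) : ℝ) : ℂ) := by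
    rw [ofReal_cpow hz.le]; push_cast; rfl
  simp only [hp, Pi.mul_apply]
  ring

/-- The cross-sectional weight cancels the decay of the profiles in the Wronskian. -/
theorem cusp_weight_mul_rpow_sq {n : ℕ} (hn : 1 ≤ n) {x : ℝ} (hx : 0 < x) :
    x ^ (2 * (n - 1)) * (x ^ (3/2 - n : ℝ)) ^ 2 * x⁻¹ = 1 := by
  rw [← Real.rpow_natCast, ← Real.rpow_natCast, ← Real.rpow_mul hx.le, ← Real.rpow_neg_one,
    ← Real.rpow_add hx, ← Real.rpow_add hx]
  push_cast [Nat.cast_sub hn]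
  ring_nf
  exact Real.rpow_zero x

/-- threshold case. The Green bracket of `w^j = b^j₊ w₊ + b^j₋ w₋`, with
`w₊(z) = w₀ z^{−n+3/2}(ln z − i)`, `w₋(z) = w₀ z^{−n+3/2}(ln z + i)`, on the cross-section at
height `ζ` (with weight `ζ^{2(n−1)}`) equals `2iw₀²(conj(b²₊)b¹₊ − conj(b²₋)b¹₋)`, and with
`w₀ = 2^{−1/2}` equals `i(conj(b²₊)b¹₊ − conj(b²₋)b¹₋)`, independently of `ζ`. -/
theorem stmt_6 (n : ℕ) (hn : 2 ≤ n) (w₀ : ℝ) (hw₀ : 0 < w₀)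
    (b1p b1m b2p b2m : ℂ) :
    let wp : ℝ → ℂ := fun z =>
      (w₀ : ℂ) * (z : ℂ) ^ ((3/2 : ℂ) - (n : ℂ)) * ((Real.log z : ℂ) - Complex.I)
    let wm : ℝ → ℂ := fun z =>
      (w₀ : ℂ) * (z : ℂ) ^ ((3/2 : ℂ) - (n : ℂ)) * ((Real.log z : ℂ) + Complex.I)
    let w1 : ℝ → ℂ := fun z => b1p * wp z + b1m * wm z
    let w2 : ℝ → ℂ := fun z => b2p * wp z + b2m * wm z
    (∀ ζ : ℝ, 0 < ζ →
      (ζ : ℂ) ^ (2 * (n - 1)) *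
          ((starRingEnd ℂ) (w2 ζ) * deriv w1 ζ - w1 ζ * (starRingEnd ℂ) (deriv w2 ζ))
        = 2 * Complex.I * (w₀ : ℂ) ^ 2 *
            ((starRingEnd ℂ) b2p * b1p - (starRingEnd ℂ) b2m * b1m)) ∧
    (w₀ = (2 : ℝ) ^ (-(1/2 : ℝ)) →
      ∀ ζ : ℝ, 0 < ζ →
        (ζ : ℂ) ^ (2 * (n - 1)) *
            ((starRingEnd ℂ) (w2 ζ) * deriv w1 ζ - w1 ζ * (starRingEnd ℂ) (deriv w2 ζ))
          = Complex.I * ((starRingEnd ℂ) b2p * b1p - (starRingEnd ℂ) b2m * b1m)) := by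
  intro wp wm w1 w2
  have key : ∀ ζ : ℝ, 0 < ζ →
      (ζ : ℂ) ^ (2 * (n - 1)) *
          ((starRingEnd ℂ) (w2 ζ) * deriv w1 ζ - w1 ζ * (starRingEnd ℂ) (deriv w2 ζ))
        = 2 * Complex.I * (w₀ : ℂ) ^ 2 *
            ((starRingEnd ℂ) b2p * b1p - (starRingEnd ℂ) b2m * b1m) := by
    intro ζ hζ
    have hp : (ζ : ℂ) ^ ((3/2 : ℂ) - (n : ℂ)) = ((ζ ^ (3/2 - n : ℝ) : ℝ) : ℂ) := by
      rw [Complex.ofReal_cpow hζ.le]; push_cast; rfl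
    have hw := congrArg (fun t : ℝ => (t : ℂ)) (cusp_weight_mul_rpow_sq (by omega : 1 ≤ n) hζ)
    rw [(hasDerivAt_cusp_profile n w₀ b1p b1m hζ).deriv,
      (hasDerivAt_cusp_profile n w₀ b2p b2m hζ).deriv]
    simp only [w1, w2, wp, wm, hp]
    simp only [Complex.ofReal_mul, Complex.ofReal_pow, Complex.ofReal_one] at hw
    simp only [map_add, map_sub, map_mul, Complex.conj_ofReal, Complex.conj_I]
    linear_combination (2 * Complex.I * (w₀ : ℂ) ^ 2 *
      ((starRingEnd ℂ) b2p * b1p - (starRingEnd ℂ) b2m * b1m)) * hw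
  refine ⟨key, fun h ζ hζ => ?_⟩
  have hsq : w₀ ^ 2 = 1 / 2 := by
    rw [h, ← Real.rpow_natCast, ← Real.rpow_mul (by norm_num)]
    norm_num [Real.rpow_neg_one]
  have hsqc : (w₀ : ℂ) ^ 2 = 1 / 2 := by
    rw [← Complex.ofReal_pow, hsq]; norm_num
  rw [key ζ hζ, hsqc]
  ring
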